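/- arXiv:2604.06516 — 2 statements merged into one kernel-verified Lean document; each statement's English description precedes it below -/
import Mathlib

section
/- Let t > 0 and let f be absolutely continuous on [0,t]. Then I_t(f) < ∞ if and only if ∫₀ᵗ |ḟ(s)|·ψ(|ḟ(s)|/p̄) ds < ∞; equivalently (since ψ is odd) if and only if ∫₀ᵗ ḟ(s)·ψ(ḟ(s)/p̄) ds < ∞. -/
open MeasureTheory Real Filter Set

noncomputable def Hfun (G : ℝ → ℝ) (α : ℝ) : ℝ := ∫ y : ℝ, (Real.exp (α * y) - 1) * G y

/-- `H'(α) = ∫ y exp (α y) G y dy`. -/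
noncomputable def Hderiv (G : ℝ → ℝ) (α : ℝ) : ℝ := ∫ y : ℝ, y * Real.exp (α * y) * G y

/-- `L(x,v) = sup_{α ∈ ℝ} (α v − p(x) H(α))`. -/
noncomputable def Lfun (G p : ℝ → ℝ) (x v : ℝ) : ℝ := ⨆ α : ℝ, (α * v - p x * Hfun G α)


lemma aux_sinh_le (w : ℝ) (hw : 0 ≤ w) : Real.sinh w ≤ w * Real.cosh w := by
  have hd : ∀ x : ℝ, HasDerivAt (fun x => x * Real.cosh x - Real.sinh x) (x * Real.sinh x) x := by
    intro x
    have := ((hasDerivAt_id x).mul (Real.hasDerivAt_cosh x)).sub (Real.hasDerivAt_sinh x)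
    refine this.congr_deriv ?_
    simp only [id]; ring
  have hm : MonotoneOn (fun x => x * Real.cosh x - Real.sinh x) (Ici 0) := by
    refine monotoneOn_of_deriv_nonneg (convex_Ici 0)
      (fun x _ => (hd x).continuousAt.continuousWithinAt)
      (fun x _ => (hd x).differentiableAt.differentiableWithinAt) ?_
    intro x hx
    rw [interior_Ici] at hx
    rw [(hd x).deriv]
    exact mul_nonneg (le_of_lt hx) (Real.sinh_nonneg_iff.2 (le_of_lt hx))
  have := hm (mem_Ici.2 le_rfl) (mem_Ici.2 hw) hw
  simp at this
  linarith

lemma aux_cosh (z : ℝ) : 2 * (Real.cosh z - 1) ≤ z * Real.sinh z := by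
  have key : ∀ z : ℝ, 0 ≤ z → 2 * (Real.cosh z - 1) ≤ z * Real.sinh z := by
    intro z hz
    obtain ⟨w, rfl⟩ : ∃ w, z = 2 * w := ⟨z / 2, by ring⟩
    have hw : 0 ≤ w := by linarith
    rw [Real.cosh_two_mul, Real.sinh_two_mul]
    have h1 := aux_sinh_le w hw
    have h2 := Real.cosh_sq w
    have h3 := mul_le_mul_of_nonneg_left h1 (Real.sinh_nonneg_iff.2 hw)
    nlinarith
  rcases le_total 0 z with h | h
  · exact key z h
  · have := key (-z) (by linarith)
    rw [Real.cosh_neg, Real.sinh_neg] at this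
    linarith

lemma aux_sinh_mul (c : ℝ) (hc : 1 ≤ c) (w : ℝ) (hw : 0 ≤ w) :
    c * Real.sinh w ≤ Real.sinh (c * w) := by
  have hd : ∀ x : ℝ, HasDerivAt (fun x => Real.sinh (c * x) - c * Real.sinh x)
      (c * (Real.cosh (c * x) - Real.cosh x)) x := by
    intro x
    have := (((hasDerivAt_id x).const_mul c).sinh).sub ((Real.hasDerivAt_sinh x).const_mul c)
    refine this.congr_deriv ?_
    simp only [id]; ring
  have hm : MonotoneOn (fun x => Real.sinh (c * x) - c * Real.sinh x) (Ici 0) := by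
    refine monotoneOn_of_deriv_nonneg (convex_Ici 0)
      (fun x _ => (hd x).continuousAt.continuousWithinAt)
      (fun x _ => (hd x).differentiableAt.differentiableWithinAt) ?_
    intro x hx
    rw [interior_Ici] at hx
    have hx' : 0 < x := hx
    rw [(hd x).deriv]
    refine mul_nonneg (by linarith) (sub_nonneg.2 (Real.cosh_le_cosh.2 ?_))
    rw [abs_of_pos hx', abs_of_nonneg (by positivity)]
    nlinarith
  have := hm (mem_Ici.2 le_rfl) (mem_Ici.2 hw) hw
  simp at this
  linarith

lemma aux_sinh_mul' (c : ℝ) (hc : 1 ≤ c) (b : ℝ) (hb : 0 ≤ b) (y : ℝ) :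
    c * (y * Real.sinh (b * y)) ≤ y * Real.sinh (c * b * y) := by
  rcases le_total 0 y with h | h
  · have := mul_le_mul_of_nonneg_left (aux_sinh_mul c hc (b * y) (by positivity)) h
    rw [← mul_assoc c b y] at this
    linarith
  · have := mul_le_mul_of_nonneg_left (aux_sinh_mul c hc (b * (-y))
      (mul_nonneg hb (by linarith))) (neg_nonneg.2 h)
    rw [← mul_assoc c b (-y), mul_neg, mul_neg, Real.sinh_neg, Real.sinh_neg] at this
    linarith

section
variable (G : ℝ → ℝ) (hGcont : Continuous G) (hGpos : ∀ y, 0 < G y)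
    (hGeven : ∀ y, G (-y) = G y)
    (hGint : Integrable G)
    (hGexp : ∀ α : ℝ, Integrable (fun y => Real.exp (α * y) * G y))

include hGcont hGpos hGexp in
lemma aux_int (α : ℝ) : Integrable (fun y => y * Real.exp (α * y) * G y) := by
  refine Integrable.mono' ((hGexp (α + 1)).add (hGexp (α - 1))) (by fun_prop) ?_
  refine Eventually.of_forall fun y => ?_
  have hy : |y| ≤ Real.exp y + Real.exp (-y) := by
    rcases abs_cases y with h | h
    · have := Real.add_one_le_exp y; have := Real.exp_pos (-y); linarith
    · have := Real.add_one_le_exp (-y); have := Real.exp_pos (y); linarith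
  have e1 : Real.exp ((α + 1) * y) = Real.exp (α * y) * Real.exp y := by
    rw [← Real.exp_add]; ring_nf
  have e2 : Real.exp ((α - 1) * y) = Real.exp (α * y) * Real.exp (-y) := by
    rw [← Real.exp_add]; ring_nf
  simp only [Pi.add_apply]
  rw [e1, e2, norm_mul, norm_mul, Real.norm_eq_abs, Real.norm_eq_abs, Real.norm_eq_abs,
    abs_of_pos (Real.exp_pos _), abs_of_pos (hGpos y)]
  have := mul_le_mul_of_nonneg_right hy (mul_pos (Real.exp_pos (α * y)) (hGpos y)).le
  linarith

include hGint hGexp in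
lemma aux_int0 (α : ℝ) : Integrable (fun y => (Real.exp (α * y) - 1) * G y) := by
  have := (hGexp α).sub hGint
  refine this.congr (Eventually.of_forall fun y => ?_)
  simp only [Pi.sub_apply]; ring

include hGcont hGpos hGint hGexp in
lemma aux_tangent (a b : ℝ) : Hfun G a + Hderiv G a * (b - a) ≤ Hfun G b := by
  unfold Hfun Hderiv
  rw [← integral_mul_const, ← integral_add (aux_int0 G hGint hGexp a)
    ((aux_int G hGcont hGpos hGexp a).mul_const _)]
  refine integral_mono ((aux_int0 G hGint hGexp a).add
    ((aux_int G hGcont hGpos hGexp a).mul_const _)) (aux_int0 G hGint hGexp b) fun y => ?_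
  have h1 : Real.exp (b * y) = Real.exp (a * y) * Real.exp ((b - a) * y) := by
    rw [← Real.exp_add]; ring_nf
  have h2 := Real.add_one_le_exp ((b - a) * y)
  have h3 := mul_le_mul_of_nonneg_left h2 (mul_pos (Real.exp_pos (a * y)) (hGpos y)).le
  simp only
  rw [h1]
  linarith

include hGeven in
lemma aux_symD (a : ℝ) : Hderiv G (-a) = - Hderiv G a := by
  unfold Hderiv
  rw [← integral_neg_eq_self, ← integral_neg]
  congr 1; ext y
  rw [hGeven, neg_mul_neg]; ring

include hGeven in
lemma aux_symH (a : ℝ) : Hfun G (-a) = Hfun G a := by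
  unfold Hfun
  rw [← integral_neg_eq_self]
  congr 1; ext y
  rw [hGeven, neg_mul_neg]

include hGcont hGpos hGeven hGexp in
lemma aux_D (a : ℝ) : Integrable (fun y => y * Real.sinh (a * y) * G y) ∧
    Hderiv G a = ∫ y, y * Real.sinh (a * y) * G y := by
  have i1 := aux_int G hGcont hGpos hGexp a
  have i2 := aux_int G hGcont hGpos hGexp (-a)
  have e : (fun y => y * Real.sinh (a * y) * G y) = fun y =>
      (1/2 : ℝ) * (y * Real.exp (a * y) * G y - y * Real.exp (-a * y) * G y) := by
    ext y; rw [Real.sinh_eq, neg_mul]; ring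
  rw [e]
  refine ⟨(i1.sub i2).const_mul _, ?_⟩
  rw [integral_const_mul, integral_sub i1 i2]
  have := aux_symD G hGeven a
  unfold Hderiv at *
  rw [this]; ring

include hGint hGeven hGexp in
lemma aux_H (a : ℝ) : Integrable (fun y => (Real.cosh (a * y) - 1) * G y) ∧
    Hfun G a = ∫ y, (Real.cosh (a * y) - 1) * G y := by
  have i1 := aux_int0 G hGint hGexp a
  have i2 := aux_int0 G hGint hGexp (-a)
  have e : (fun y => (Real.cosh (a * y) - 1) * G y) = fun y =>
      (1/2 : ℝ) * ((Real.exp (a * y) - 1) * G y + (Real.exp (-a * y) - 1) * G y) := by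
    ext y; rw [Real.cosh_eq, neg_mul]; ring
  rw [e]
  refine ⟨(i1.add i2).const_mul _, ?_⟩
  rw [integral_const_mul, integral_add i1 i2]
  have := aux_symH G hGeven a
  unfold Hfun at *
  rw [this]; ring

include hGcont hGpos hGeven hGint hGexp in
lemma aux_half (a : ℝ) : 2 * Hfun G a ≤ a * Hderiv G a := by
  obtain ⟨i1, e1⟩ := aux_D G hGcont hGpos hGeven hGexp a
  obtain ⟨i2, e2⟩ := aux_H G hGeven hGint hGexp a
  rw [e1, e2, ← integral_const_mul, ← integral_const_mul]
  refine integral_mono (i2.const_mul _) (i1.const_mul _) fun y => ?_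
  have := mul_le_mul_of_nonneg_right (aux_cosh (a * y)) (hGpos y).le
  simp only
  linarith

include hGpos hGeven hGint hGexp in
lemma aux_Hnonneg (a : ℝ) : 0 ≤ Hfun G a := by
  rw [(aux_H G hGeven hGint hGexp a).2]
  exact integral_nonneg fun y => mul_nonneg (by linarith [Real.one_le_cosh (a * y)]) (hGpos y).le

include hGcont hGpos hGeven hGexp in
lemma aux_Dmul (c : ℝ) (hc : 1 ≤ c) (b : ℝ) (hb : 0 ≤ b) :
    c * Hderiv G b ≤ Hderiv G (c * b) := by
  obtain ⟨i1, e1⟩ := aux_D G hGcont hGpos hGeven hGexp b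
  obtain ⟨i2, e2⟩ := aux_D G hGcont hGpos hGeven hGexp (c * b)
  rw [e1, e2, ← integral_const_mul]
  refine integral_mono (i1.const_mul _) i2 fun y => ?_
  have := mul_le_mul_of_nonneg_right (aux_sinh_mul' c hc b hb y) (hGpos y).le
  simp only
  linarith

include hGcont hGpos hGexp hGint in
lemma aux_Dmono : Monotone (Hderiv G) := by
  intro a b hab
  rcases hab.eq_or_lt with rfl | h
  · rfl
  have h1 := aux_tangent G hGcont hGpos hGint hGexp a b
  have h2 := aux_tangent G hGcont hGpos hGint hGexp b a
  have h3 : (Hderiv G b - Hderiv G a) * (b - a) ≥ 0 := by linarith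
  have := nonneg_of_mul_nonneg_left h3 (sub_pos.2 h)
  linarith

include hGcont in
lemma aux_Hmeas : Measurable (Hfun G) := by
  have : StronglyMeasurable (Function.uncurry fun (α y : ℝ) => (Real.exp (α * y) - 1) * G y) := by
    apply Continuous.stronglyMeasurable
    unfold Function.uncurry
    fun_prop
  exact (this.integral_prod_right (ν := (volume : Measure ℝ))).measurable

end

/-- Let `t > 0` and `f` absolutely continuous on `[0,t]` with (integrable)
derivative `f'`. Then `I_t(f) < ∞` (i.e. `u ↦ L(f(u), f'(u))` is integrable on `[0,t]`;
note `L ≥ 0`) iff `∫₀ᵗ |f'(s)|·ψ(|f'(s)|/p̄) ds < ∞`, equivalently (as `ψ` is odd) iff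
`∫₀ᵗ f'(s)·ψ(f'(s)/p̄) ds < ∞` (these integrands being nonnegative, finiteness is
integrability). -/
theorem stmt10 (G p : ℝ → ℝ)
    (hGcont : Continuous G) (hGpos : ∀ y, 0 < G y) (hGeven : ∀ y, G (-y) = G y)
    (hGint : Integrable G) (hGprob : ∫ y : ℝ, G y = 1)
    (hGexp : ∀ α : ℝ, Integrable (fun y => Real.exp (α * y) * G y))
    (ψ : ℝ → ℝ) (hψ₁ : ∀ x, Hderiv G (ψ x) = x) (hψ₂ : ∀ α, ψ (Hderiv G α) = α)
    (hpLip : LocallyLipschitz p)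
    (pl pu : ℝ) (hpl : 0 < pl) (hp : ∀ x, pl ≤ p x ∧ p x ≤ pu)
    (t : ℝ) (ht : 0 < t) (f f' : ℝ → ℝ)
    (hf'int : IntegrableOn f' (Icc 0 t))
    (hAC : ∀ s ∈ Icc (0 : ℝ) t, f s = f 0 + ∫ u in (0 : ℝ)..s, f' u) :
    (IntegrableOn (fun u => Lfun G p (f u) (f' u)) (Icc 0 t) ↔
      IntegrableOn (fun u => |f' u| * ψ (|f' u| / pu)) (Icc 0 t)) ∧
    (IntegrableOn (fun u => Lfun G p (f u) (f' u)) (Icc 0 t) ↔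
      IntegrableOn (fun u => f' u * ψ (f' u / pu)) (Icc 0 t)) := by
  have hpu : 0 < pu := hpl.trans_le ((hp 0).1.trans (hp 0).2)
  have hψmono : Monotone ψ := by
    intro x x' h
    by_contra! hc
    have := aux_Dmono G hGcont hGpos hGint hGexp hc.le
    rw [hψ₁, hψ₁] at this
    have : x = x' := le_antisymm h this
    subst this
    exact lt_irrefl _ hc
  have hψodd : ∀ x, ψ (-x) = - ψ x := by
    intro x
    conv_lhs => rw [← hψ₁ x, ← aux_symD G hGeven, hψ₂]
  have hψ0 : ψ 0 = 0 := by
    have := hψodd 0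
    simp at this; linarith
  have hψnn : ∀ x, 0 ≤ x → 0 ≤ ψ x := fun x hx => hψ0 ▸ hψmono hx
  have habs : ∀ v q : ℝ, |v| * ψ (|v| / q) = v * ψ (v / q) := by
    intro v q
    rcases abs_cases v with h | h
    · rw [h.1]
    · rw [h.1, neg_div, hψodd]; ring
  have hψc : ∀ c x : ℝ, 1 ≤ c → 0 ≤ x → ψ (c * x) ≤ c * ψ x := by
    intro c x hc hx
    have := hψmono (aux_Dmul G hGcont hGpos hGeven hGexp c hc (ψ x) (hψnn x hx))
    rwa [hψ₂, hψ₁] at this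
  have hpp : ∀ x, 0 < p x := fun x => hpl.trans_le (hp x).1
  have hbd : ∀ x v α, α * v - p x * Hfun G α ≤ ψ (v / p x) * v - p x * Hfun G (ψ (v / p x)) := by
    intro x v α
    have h := aux_tangent G hGcont hGpos hGint hGexp (ψ (v / p x)) α
    rw [hψ₁] at h
    have h2 := mul_le_mul_of_nonneg_left h (hpp x).le
    have h3 : p x * (v / p x) = v := by have := (hpp x).ne'; field_simp
    have h4 : p x * (Hfun G (ψ (v / p x)) + v / p x * (α - ψ (v / p x)))
      = p x * Hfun G (ψ (v / p x)) + (p x * (v / p x)) * (α - ψ (v / p x)) := by ring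
    rw [h4, h3] at h2
    linarith
  have hBdd : ∀ x v, BddAbove (range fun α => α * v - p x * Hfun G α) := fun x v =>
    ⟨_, by rintro _ ⟨α, rfl⟩; exact hbd x v α⟩
  have hLeq : ∀ x v, Lfun G p x v = ψ (v / p x) * v - p x * Hfun G (ψ (v / p x)) := fun x v =>
    le_antisymm (ciSup_le fun α => hbd x v α) (le_ciSup (hBdd x v) (ψ (v / p x)))
  have hlow : ∀ x v, v * ψ (v / pu) ≤ 2 * Lfun G p x v := by
    intro x v
    have h1 : ψ (v / pu) * v - p x * Hfun G (ψ (v / pu)) ≤ Lfun G p x v :=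
      le_ciSup (hBdd x v) (ψ (v / pu))
    have h2 := aux_half G hGcont hGpos hGeven hGint hGexp (ψ (v / pu))
    rw [hψ₁] at h2
    have h3 := mul_le_mul_of_nonneg_right (hp x).2
      (aux_Hnonneg G hGpos hGeven hGint hGexp (ψ (v / pu)))
    have h4 := mul_le_mul_of_nonneg_left h2 hpu.le
    have h5 : pu * (ψ (v / pu) * (v / pu)) = ψ (v / pu) * v := by
      have := hpu.ne'; field_simp
    rw [h5] at h4
    linarith
  have hnn : ∀ v, 0 ≤ v * ψ (v / pu) := by
    intro v
    rw [← habs]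
    exact mul_nonneg (abs_nonneg _) (hψnn _ (by positivity))
  have hup : ∀ x v, Lfun G p x v ≤ (pu / pl) * (v * ψ (v / pu)) := by
    intro x v
    have h1 : Lfun G p x v ≤ v * ψ (v / p x) := by
      rw [hLeq]
      have := mul_nonneg (hpp x).le (aux_Hnonneg G hGpos hGeven hGint hGexp (ψ (v / p x)))
      linarith
    refine h1.trans ?_
    rw [← habs v (p x), ← habs v pu]
    have h2 : |v| / p x = (pu / p x) * (|v| / pu) := by
      have := (hpp x).ne'; have := hpu.ne'; field_simp
    have h3 := hψc (pu / p x) (|v| / pu) ((one_le_div (hpp x)).2 (hp x).2) (by positivity)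
    rw [← h2] at h3
    have h4 : pu / p x ≤ pu / pl := div_le_div_of_nonneg_left hpu.le hpl (hp x).1
    have h5 := mul_le_mul_of_nonneg_right h4 (hψnn (|v| / pu) (by positivity))
    have h6 := mul_le_mul_of_nonneg_left (h3.trans h5) (abs_nonneg v)
    linarith
  have hψm : Measurable ψ := hψmono.measurable
  have hHm := aux_Hmeas G hGcont
  have hf'm : AEMeasurable f' (volume.restrict (Icc 0 t)) := hf'int.aestronglyMeasurable.aemeasurable
  have hfc : ContinuousOn f (Icc 0 t) := by
    have h := (intervalIntegral.continuousOn_primitive_interval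
      (f := f') (μ := volume) (a := 0) (b := t) (by rwa [uIcc_of_le ht.le]))
    rw [uIcc_of_le ht.le] at h
    exact (continuousOn_const.add h).congr hAC
  have hfm : AEMeasurable f (volume.restrict (Icc 0 t)) := hfc.aemeasurable measurableSet_Icc
  have hpm : AEMeasurable (fun u => p (f u)) (volume.restrict (Icc 0 t)) :=
    hpLip.continuous.measurable.comp_aemeasurable hfm
  have hRm : AEMeasurable (fun u => f' u * ψ (f' u / pu)) (volume.restrict (Icc 0 t)) :=
    hf'm.mul (hψm.comp_aemeasurable (hf'm.div_const _))
  have hLm : AEMeasurable (fun u => Lfun G p (f u) (f' u)) (volume.restrict (Icc 0 t)) := by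
    simp only [hLeq]
    have h := hψm.comp_aemeasurable (hf'm.div hpm)
    exact (h.mul hf'm).sub (hpm.mul (hHm.comp_aemeasurable h))
  have main : IntegrableOn (fun u => Lfun G p (f u) (f' u)) (Icc 0 t) ↔
      IntegrableOn (fun u => f' u * ψ (f' u / pu)) (Icc 0 t) := by
    constructor
    · intro h
      refine Integrable.mono' (h.const_mul 2) hRm.aestronglyMeasurable
        (Eventually.of_forall fun u => ?_)
      rw [Real.norm_eq_abs, abs_of_nonneg (hnn _)]
      exact hlow _ _
    · intro h
      refine Integrable.mono' (h.const_mul (pu / pl)) hLm.aestronglyMeasurable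
        (Eventually.of_forall fun u => ?_)
      have := hlow (f u) (f' u)
      have := hnn (f' u)
      rw [Real.norm_eq_abs, abs_of_nonneg (by linarith)]
      exact hup _ _
  refine ⟨?_, main⟩
  simp only [habs]
  exact main
end

section
/- Assume in addition that p is continuously differentiable. Let t > 0 and f ∈ C²([0,t]), and set ψ_f(s) = ψ(ḟ(s)/p(f(s))) for s ∈ [0,t]. Then I_t(f) = ψ_f(t)·f(t) − ψ_f(0)·f(0) − ∫₀ᵗ ( f(s)·ψ_f'(s) + p(f(s))·H(ψ_f(s)) ) ds. -/
open MeasureTheory Real Filter Set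

noncomputable def Mom (G : ℝ → ℝ) (n : ℕ) (α : ℝ) : ℝ := ∫ y : ℝ, y ^ n * Real.exp (α * y) * G y

theorem mom_aux (G : ℝ → ℝ) (hGcont : Continuous G) (hGpos : ∀ y, 0 < G y)
    (hGexp : ∀ α : ℝ, Integrable (fun y => Real.exp (α * y) * G y)) (n : ℕ) (α : ℝ) :
    Integrable (fun y => y ^ n * Real.exp (α * y) * G y) ∧
      HasDerivAt (Mom G n) (Mom G (n + 1) α) α := by
  have hm : Measurable (fun y => (G y).toNNReal) := hGcont.measurable.real_toNNReal
  set μ : Measure ℝ := volume.withDensity (fun y => ((G y).toNNReal : ENNReal)) with hμ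
  have hc : ∀ (h : ℝ → ℝ), (fun y => (G y).toNNReal • h y) = fun y => h y * G y := by
    intro h; funext y
    rw [NNReal.smul_def, Real.coe_toNNReal _ (hGpos y).le, smul_eq_mul, mul_comm]
  have hset : ProbabilityTheory.integrableExpSet (fun y : ℝ => y) μ = Set.univ := by
    ext a
    simp only [ProbabilityTheory.integrableExpSet, Set.mem_ofPred_eq, Set.mem_univ, iff_true]
    rw [hμ, integrable_withDensity_iff_integrable_smul hm, hc]
    exact hGexp a
  have hin : ∀ a, a ∈ interior (ProbabilityTheory.integrableExpSet (fun y : ℝ => y) μ) := by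
    intro a; rw [hset]; simp
  have hM : ∀ k, Mom G k = fun a => ∫ y, y ^ k * Real.exp (a * y) ∂μ := by
    intro k; funext a
    rw [hμ, integral_withDensity_eq_integral_smul hm, hc]; rfl
  constructor
  · have := ProbabilityTheory.integrable_pow_mul_exp_of_mem_interior_integrableExpSet (hin α) n
    rwa [hμ, integrable_withDensity_iff_integrable_smul hm, hc] at this
  · rw [hM, hM]
    exact ProbabilityTheory.hasDerivAt_integral_pow_mul_exp_real (hin α) n

theorem mom_two_pos (G : ℝ → ℝ) (hGcont : Continuous G) (hGpos : ∀ y, 0 < G y)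
    (hGexp : ∀ α : ℝ, Integrable (fun y => Real.exp (α * y) * G y)) (α : ℝ) :
    0 < Mom G 2 α := by
  unfold Mom
  rw [integral_pos_iff_support_of_nonneg _ (mom_aux G hGcont hGpos hGexp 2 α).1]
  · have : Function.support (fun y => y ^ 2 * Real.exp (α * y) * G y) = {0}ᶜ := by
      ext y
      have h1 := (hGpos y).ne'
      simp [h1]
    rw [this]
    exact isOpen_compl_singleton.measure_pos _ ⟨1, by simp⟩
  · intro y
    have := hGpos y
    simp only [Pi.zero_apply]
    positivity

theorem Hderiv_eq (G : ℝ → ℝ) : Hderiv G = Mom G 1 := by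
  funext a; simp [Hderiv, Mom]

theorem Hfun_eq (G : ℝ → ℝ) (hGint : Integrable G)
    (hGexp : ∀ α : ℝ, Integrable (fun y => Real.exp (α * y) * G y)) (α : ℝ) :
    Hfun G α = Mom G 0 α - ∫ y, G y := by
  simp only [Hfun, Mom, pow_zero, one_mul]
  rw [← integral_sub (hGexp α) hGint]
  congr 1; funext y; ring

theorem Hfun_tangent (G : ℝ → ℝ) (hGcont : Continuous G) (hGpos : ∀ y, 0 < G y)
    (hGint : Integrable G)
    (hGexp : ∀ α : ℝ, Integrable (fun y => Real.exp (α * y) * G y)) (a b : ℝ) :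
    Hfun G b + (a - b) * Hderiv G b ≤ Hfun G a := by
  rw [Hfun_eq G hGint hGexp, Hfun_eq G hGint hGexp, Hderiv_eq]
  have h0 := fun c => (mom_aux G hGcont hGpos hGexp 0 c).1
  have h1 := (mom_aux G hGcont hGpos hGexp 1 b).1
  have : Mom G 0 b + (a - b) * Mom G 1 b ≤ Mom G 0 a := by
    unfold Mom
    rw [← integral_const_mul, ← integral_add (h0 b) (h1.const_mul _)]
    refine integral_mono ((h0 b).add (h1.const_mul _)) (h0 a) fun y => ?_
    have e : Real.exp (a * y) = Real.exp (b * y) * Real.exp ((a - b) * y) := by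
      rw [← Real.exp_add]; ring_nf
    have l := Real.add_one_le_exp ((a - b) * y)
    have hG := hGpos y
    have hE := Real.exp_pos (b * y)
    have k := mul_le_mul_of_nonneg_left l (mul_pos hE hG).le
    simp only [pow_zero, one_mul, pow_one]
    rw [e]
    nlinarith [k]
  linarith

/-- Assume moreover `p` is `C¹`. Let `t > 0` and `f ∈ C²([0,t])` with
derivative `f'`, and set `ψ_f(s) = ψ(f'(s)/p(f(s)))` (here `g`), with derivative `g'`.
Then `I_t(f) = ψ_f(t)·f(t) − ψ_f(0)·f(0) − ∫₀ᵗ (f(s)·ψ_f'(s) + p(f(s))·H(ψ_f(s))) ds`. -/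
theorem stmt11 (G p : ℝ → ℝ)
    (hGcont : Continuous G) (hGpos : ∀ y, 0 < G y) (hGeven : ∀ y, G (-y) = G y)
    (hGint : Integrable G) (hGprob : ∫ y : ℝ, G y = 1)
    (hGexp : ∀ α : ℝ, Integrable (fun y => Real.exp (α * y) * G y))
    (ψ : ℝ → ℝ) (hψ₁ : ∀ x, Hderiv G (ψ x) = x) (hψ₂ : ∀ α, ψ (Hderiv G α) = α)
    (hpLip : LocallyLipschitz p) (hpC1 : ContDiff ℝ 1 p)
    (pl pu : ℝ) (hpl : 0 < pl) (hp : ∀ x, pl ≤ p x ∧ p x ≤ pu)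
    (t : ℝ) (ht : 0 < t) (f f' : ℝ → ℝ)
    (hfC2 : ContDiffOn ℝ 2 f (Icc 0 t))
    (hf' : ∀ s ∈ Icc (0 : ℝ) t, HasDerivWithinAt f (f' s) (Icc 0 t) s)
    (g g' : ℝ → ℝ)
    (hg : ∀ s, g s = ψ (f' s / p (f s)))
    (hg' : ∀ s ∈ Icc (0 : ℝ) t, HasDerivWithinAt g (g' s) (Icc 0 t) s) :
    (∫ u in (0 : ℝ)..t, Lfun G p (f u) (f' u)) =
      g t * f t - g 0 * f 0 -
        ∫ s in (0 : ℝ)..t, (f s * g' s + p (f s) * Hfun G (g s)) := by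
  have hppos : ∀ x, 0 < p x := fun x => lt_of_lt_of_le hpl (hp x).1
  have hL : ∀ u, Lfun G p (f u) (f' u) = g u * f' u - p (f u) * Hfun G (g u) := by
    intro u
    have hb : ∀ α : ℝ, α * f' u - p (f u) * Hfun G α ≤
        g u * f' u - p (f u) * Hfun G (g u) := by
      intro α
      have h := Hfun_tangent G hGcont hGpos hGint hGexp α (g u)
      rw [hg u, hψ₁, ← hg u] at h
      have h2 := mul_le_mul_of_nonneg_left h (hppos (f u)).le
      have h3 : p (f u) * (f' u / p (f u)) = f' u := by
        field_simp [(hppos (f u)).ne']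
      have h4 : p (f u) * (Hfun G (g u) + (α - g u) * (f' u / p (f u))) =
        p (f u) * Hfun G (g u) + (α - g u) * f' u := by
        linear_combination (α - g u) * h3
      linarith
    unfold Lfun
    exact le_antisymm (ciSup_le hb)
      (le_ciSup (f := fun α : ℝ => α * f' u - p (f u) * Hfun G α) ⟨_, by rintro _ ⟨α, rfl⟩; exact hb α⟩ (g u))
  have hU : UniqueDiffOn ℝ (Icc (0:ℝ) t) := uniqueDiffOn_Icc ht
  have hfc : ContinuousOn f (Icc 0 t) := hfC2.continuousOn
  have hgc : ContinuousOn g (Icc 0 t) := fun s hs => (hg' s hs).continuousWithinAt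
  have hf'C1 : ContDiffOn ℝ 1 f' (Icc 0 t) :=
    (hfC2.derivWithin hU (m := 1) (by norm_num)).congr
      fun s hs => ((hf' s hs).derivWithin (hU s hs)).symm
  have hqC1 : ContDiffOn ℝ 1 (fun s => f' s / p (f s)) (Icc 0 t) :=
    hf'C1.div (hpC1.comp_contDiffOn (hfC2.of_le (by norm_num))) fun s _ => (hppos (f s)).ne'
  have hq' : ContinuousOn (derivWithin (fun s => f' s / p (f s)) (Icc 0 t)) (Icc 0 t) :=
    hqC1.continuousOn_derivWithin hU le_rfl
  have hM := mom_aux G hGcont hGpos hGexp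
  have hMc : ∀ n, Continuous (Mom G n) := fun n =>
    continuous_iff_continuousAt.2 fun a => (hM n a).2.continuousAt
  have hg'c : ContinuousOn g' (Icc 0 t) := by
    refine (hq'.div ((hMc 2).comp_continuousOn hgc)
      fun s _ => (mom_two_pos G hGcont hGpos hGexp _).ne').congr fun s hs => ?_
    have hd := ((hM 1 (g s)).2.comp_hasDerivWithinAt s (hg' s hs))
    have he : (Mom G 1 ∘ g) = fun s => f' s / p (f s) := by
      funext r
      simp only [Function.comp]
      rw [← Hderiv_eq, hg, hψ₁]
    rw [he] at hd
    have := (mom_two_pos G hGcont hGpos hGexp (g s)).ne'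
    rw [Pi.div_apply, hd.derivWithin (hU s hs)]
    simp only [Function.comp]
    field_simp
  have hHc : Continuous (Hfun G) := by
    have : Hfun G = fun a => Mom G 0 a - ∫ y, G y := funext (Hfun_eq G hGint hGexp)
    rw [this]; exact (hMc 0).sub continuous_const
  have hpH : ContinuousOn (fun s => p (f s) * Hfun G (g s)) (Icc 0 t) :=
    (hpC1.continuous.comp_continuousOn hfc).mul (hHc.comp_continuousOn hgc)
  have hI : ∀ {h : ℝ → ℝ}, ContinuousOn h (Icc 0 t) → IntervalIntegrable h volume 0 t :=
    fun h => h.intervalIntegrable_of_Icc ht.le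
  simp_rw [hL]
  rw [intervalIntegral.integral_sub (hI (h := fun s => g s * f' s) (hgc.mul hf'C1.continuousOn)) (hI hpH),
    intervalIntegral.integral_add (hI (h := fun s => f s * g' s) (hfc.mul hg'c)) (hI hpH),
    intervalIntegral.integral_mul_deriv_eq_deriv_mul_of_hasDerivWithinAt (u := g) (v := f)
      (u' := g') (v' := f') (by rwa [uIcc_of_le ht.le]) (by rwa [uIcc_of_le ht.le])
      (hI hg'c) (hI hf'C1.continuousOn)]
  simp_rw [mul_comm (g' _)]
  ring
end
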